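/- arXiv:1306.3609 — 2 statements merged into one kernel-verified Lean document; each statement's English description precedes it below -/
import Mathlib

section
/- (Minimax rate in the Gaussian sequence model under squared ℓ_q loss) Fix q ∈ (1, ∞). There exist constants c_q, C_q > 0 depending only on q such that for every d ≥ 1, in the Gaussian location model Y = θ + Z with θ ∈ ℝ^d and Z a standard Gaussian vector in ℝ^d (law equal to the d-fold product of N(0,1)), c_q · d^{2/q} ≤ inf_{θ̂} sup_{θ ∈ ℝ^d} E[ ‖θ̂(θ + Z) − θ‖_{ℓ_q}² ] ≤ C_q · d^{2/q}, where the infimum is over all measurable maps θ̂ : ℝ^d → ℝ^d and ‖x‖_{ℓ_q} = (Σ_{i=1}^d |x_i|^q)^{1/q}. -/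
open MeasureTheory ProbabilityTheory
open scoped ENNReal

/-- The standard Gaussian measure on `ℝ^d`, the `d`-fold product of `N(0,1)`. -/
noncomputable def stdGaussianPi (d : ℕ) : Measure (Fin d → ℝ) :=
  Measure.pi fun _ : Fin d => gaussianReal 0 1

/-- The `ℓ_q` norm on `ℝ^d`. -/
noncomputable def lqNorm {d : ℕ} (q : ℝ) (x : Fin d → ℝ) : ℝ :=
  (∑ i, |x i| ^ q) ^ (1 / q)

theorem lqNorm_nonneg {d : ℕ} (q : ℝ) (x : Fin d → ℝ) : 0 ≤ lqNorm q x := by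
  unfold lqNorm; positivity

theorem lqNorm_neg {d : ℕ} (q : ℝ) (x : Fin d → ℝ) : lqNorm q (-x) = lqNorm q x := by
  simp [lqNorm]

theorem measurable_lqNorm {d : ℕ} (q : ℝ) : Measurable (lqNorm q : (Fin d → ℝ) → ℝ) := by
  unfold lqNorm; fun_prop

theorem lqNorm_sub_le {d : ℕ} {q : ℝ} (hq : 1 ≤ q) (x y : Fin d → ℝ) :
    lqNorm q (x - y) ≤ lqNorm q x + lqNorm q y := by
  rw [sub_eq_add_neg, ← lqNorm_neg q y]
  exact Real.Lp_add_le Finset.univ x (-y) hq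

theorem lqNorm_sub_sq_le {d : ℕ} {q : ℝ} (hq : 1 ≤ q) (x y : Fin d → ℝ) :
    lqNorm q (x - y) ^ 2 ≤ 2 * (lqNorm q x ^ 2 + lqNorm q y ^ 2) :=
  (pow_le_pow_left₀ (lqNorm_nonneg _ _) (lqNorm_sub_le hq x y) 2).trans add_sq_le

/-- The squared `ℓ_q` norm, in terms of the empirical `q`-th moment of the coordinates. -/
theorem lqNorm_sq_eq {d : ℕ} (hd : 1 ≤ d) (q : ℝ) (x : Fin d → ℝ) :
    lqNorm q x ^ 2 = (d : ℝ) ^ (2 / q) * ((∑ i, |x i| ^ q) / d) ^ (2 / q) := by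
  have hd' : (0 : ℝ) < d := by exact_mod_cast hd
  have hS : 0 ≤ ∑ i, |x i| ^ q := by positivity
  rw [← Real.mul_rpow hd'.le (by positivity), mul_div_cancel₀ _ hd'.ne', lqNorm,
    ← Real.rpow_natCast, ← Real.rpow_mul hS]
  congr 1
  push_cast
  ring

theorem lqNorm_sq_le {d : ℕ} (hd : 1 ≤ d) {q : ℝ} (hq : 1 ≤ q) (x : Fin d → ℝ) :
    lqNorm q x ^ 2 ≤ (d : ℝ) ^ (2 / q) * (1 + (∑ i, |x i| ^ (2 * q)) / d) := by
  have hd' : (0 : ℝ) < d := by exact_mod_cast hd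
  have hq0 : 0 < q := by linarith
  rw [lqNorm_sq_eq hd]
  gcongr
  set a := (∑ i, |x i| ^ q) / d with ha
  have ha0 : 0 ≤ a := by positivity
  have hmean : a ^ 2 ≤ (∑ i, |x i| ^ (2 * q)) / d := by
    have h := sq_sum_le_card_mul_sum_sq (s := Finset.univ) (f := fun i => |x i| ^ q)
    have h2 : ∀ i, (|x i| ^ q) ^ 2 = |x i| ^ (2 * q) := fun i => by
      rw [← Real.rpow_natCast, ← Real.rpow_mul (abs_nonneg _)]
      congr 1
      push_cast
      ring
    simp only [h2, Finset.card_univ, Fintype.card_fin] at h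
    rw [ha, div_pow, div_le_div_iff₀ (by positivity) hd']
    nlinarith
  rcases le_total a 1 with h1 | h1
  · have := Real.rpow_le_one ha0 h1 (by positivity : 0 ≤ 2 / q)
    nlinarith [sq_nonneg a]
  · have : a ^ (2 / q) ≤ a ^ (2 : ℝ) :=
      Real.rpow_le_rpow_of_exponent_le h1 (by rw [div_le_iff₀ hq0]; linarith)
    rw [Real.rpow_two] at this
    linarith

theorem le_lqNorm_sq {d : ℕ} (hd : 1 ≤ d) {q : ℝ} (hq : 1 ≤ q) (x : Fin d → ℝ) :
    (d : ℝ) ^ (2 / q) * ((∑ i, min (|x i| ^ q) 1) / d) ^ 2 ≤ lqNorm q x ^ 2 := by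
  have hd' : (0 : ℝ) < d := by exact_mod_cast hd
  have hq0 : 0 < q := by linarith
  rw [lqNorm_sq_eq hd]
  gcongr
  set b := (∑ i, min (|x i| ^ q) 1) / d with hb
  have hb0 : 0 ≤ b := by positivity
  have hb1 : b ≤ 1 := by
    rw [hb, div_le_one hd']
    calc ∑ i, min (|x i| ^ q) 1 ≤ ∑ _i : Fin d, (1 : ℝ) :=
          Finset.sum_le_sum fun i _ => min_le_right _ _
      _ = d := by simp
  calc b ^ 2 = b ^ (2 : ℝ) := (Real.rpow_two b).symm
    _ ≤ b ^ (2 / q) :=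
      Real.rpow_le_rpow_of_exponent_ge_of_imp hb0 hb1 (by rw [div_le_iff₀ hq0]; linarith)
        (fun _ h => absurd h (by positivity))
    _ ≤ ((∑ i, |x i| ^ q) / d) ^ (2 / q) := by
      rw [hb]
      gcongr with i
      exact min_le_left (|x i| ^ q) 1

instance (d : ℕ) : IsProbabilityMeasure (stdGaussianPi d) := by
  unfold stdGaussianPi; infer_instance

theorem measurePreserving_eval_stdGaussianPi {d : ℕ} (i : Fin d) :
    MeasurePreserving (fun z : Fin d → ℝ => z i) (stdGaussianPi d) (gaussianReal 0 1) :=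
  measurePreserving_eval (fun _ : Fin d => gaussianReal 0 1) i

theorem integrable_abs_rpow_gaussianReal {p : ℝ} (hp : 0 < p) :
    Integrable (fun x : ℝ => |x| ^ p) (gaussianReal 0 1) := by
  have h := (memLp_id_gaussianReal (μ := 0) (v := 1) p.toNNReal).integrable_norm_rpow
    (by simpa using hp) (by simp)
  simpa [hp.le] using h

theorem lintegral_lqNorm_sq_stdGaussianPi_le {d : ℕ} (hd : 1 ≤ d) {q : ℝ} (hq : 1 ≤ q) :
    ∫⁻ z, ENNReal.ofReal (lqNorm q z ^ 2) ∂(stdGaussianPi d) ≤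
      ENNReal.ofReal ((1 + ∫ x, |x| ^ (2 * q) ∂(gaussianReal 0 1)) * (d : ℝ) ^ (2 / q)) := by
  have hd' : (0 : ℝ) < d := by exact_mod_cast hd
  have hint := integrable_abs_rpow_gaussianReal (p := 2 * q) (by linarith)
  have hint_i : ∀ i : Fin d, Integrable (fun z : Fin d → ℝ => |z i| ^ (2 * q))
      (stdGaussianPi d) := fun i =>
    (measurePreserving_eval_stdGaussianPi i).integrable_comp_of_integrable hint
  have hval : ∀ i : Fin d, ∫ z, |z i| ^ (2 * q) ∂(stdGaussianPi d) =
      ∫ x, |x| ^ (2 * q) ∂(gaussianReal 0 1) := fun i => by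
    rw [← (measurePreserving_eval_stdGaussianPi i).map_eq,
      integral_map (measurable_pi_apply i).aemeasurable
        (Measurable.aestronglyMeasurable (by fun_prop))]
  have hsum := (integrable_finsetSum Finset.univ fun i _ => hint_i i).div_const (d : ℝ)
  have hone := integrable_const (μ := stdGaussianPi d) (1 : ℝ)
  have hcast : ∫ z, (d : ℝ) ^ (2 / q) * (1 + (∑ i, |z i| ^ (2 * q)) / d) ∂(stdGaussianPi d) =
      (1 + ∫ x, |x| ^ (2 * q) ∂(gaussianReal 0 1)) * (d : ℝ) ^ (2 / q) := by
    rw [integral_const_mul, integral_add hone hsum, integral_div,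
      integral_finsetSum _ fun i _ => hint_i i]
    simp only [hval, integral_const, probReal_univ, smul_eq_mul, Finset.sum_const,
      Finset.card_univ, Fintype.card_fin, nsmul_eq_mul]
    field_simp
  have hbound : Integrable (fun z => (d : ℝ) ^ (2 / q) * (1 + (∑ i, |z i| ^ (2 * q)) / d))
      (stdGaussianPi d) := (hone.add hsum).const_mul _
  rw [← hcast, ofReal_integral_eq_lintegral_ofReal hbound
    (Filter.Eventually.of_forall fun z => by simp only [Pi.zero_apply]; positivity)]
  exact lintegral_mono fun z => ENNReal.ofReal_le_ofReal (lqNorm_sq_le hd hq z)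

theorem ofReal_integral_le_lintegral_ofReal {Ω : Type*} [MeasurableSpace Ω] {μ : Measure Ω}
    {f : Ω → ℝ} (hf : Integrable f μ) :
    ENNReal.ofReal (∫ ω, f ω ∂μ) ≤ ∫⁻ ω, ENNReal.ofReal (f ω) ∂μ := by
  calc ENNReal.ofReal (∫ ω, f ω ∂μ) ≤ ENNReal.ofReal (∫ ω, max (f ω) 0 ∂μ) :=
        ENNReal.ofReal_le_ofReal (integral_mono hf hf.pos_part fun ω => le_max_left _ _)
    _ = ∫⁻ ω, ENNReal.ofReal (f ω) ∂μ := by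
      rw [ofReal_integral_eq_lintegral_ofReal hf.pos_part
        (Filter.Eventually.of_forall fun ω => le_max_right _ _)]
      simp only [ENNReal.ofReal_max, ENNReal.ofReal_zero, max_zero]

/-- The mean of `min (|X - Y| ^ q) 1` for independent standard Gaussian `X` and `Y`. -/
noncomputable def truncatedGaussianMoment (q : ℝ) : ℝ :=
  ∫ p : ℝ × ℝ, min (|p.1 - p.2| ^ q) 1 ∂((gaussianReal 0 1).prod (gaussianReal 0 1))

theorem integrable_min_abs_rpow_one {Ω : Type*} [MeasurableSpace Ω] {μ : Measure Ω}
    [IsFiniteMeasure μ] {f : Ω → ℝ} (hf : Measurable f) (q : ℝ) :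
    Integrable (fun ω => min (|f ω| ^ q) 1) μ := by
  refine .of_bound (C := 1) (Measurable.aestronglyMeasurable (by fun_prop))
    (Filter.Eventually.of_forall fun ω => ?_)
  rw [Real.norm_of_nonneg (by positivity)]
  exact min_le_right _ _

theorem truncatedGaussianMoment_pos (q : ℝ) : 0 < truncatedGaussianMoment q := by
  have hnn : 0 ≤ fun p : ℝ × ℝ => min (|p.1 - p.2| ^ q) 1 := fun p => by
    simp only [Pi.zero_apply]; positivity
  refine lt_of_le_of_ne (integral_nonneg hnn) fun h => ?_
  have hae := (integral_eq_zero_iff_of_nonneg hnn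
    (integrable_min_abs_rpow_one (measurable_fst.sub measurable_snd) q)).1 h.symm
  obtain ⟨x, hx⟩ := (Measure.ae_ae_of_ae_prod hae).exists
  have := nullSingletonClass_gaussianReal (μ := 0) (v := 1) one_ne_zero
  obtain ⟨y, hy, hxy⟩ := (hx.and (Measure.ae_ne (gaussianReal 0 1) x)).exists
  have h1 : 0 < |x - y| := abs_pos.2 (sub_ne_zero.2 hxy.symm)
  have h2 : 0 < min (|x - y| ^ q) 1 := lt_min (by positivity) one_pos
  exact h2.ne' hy

theorem le_lintegral_lqNorm_sub_sq {d : ℕ} (hd : 1 ≤ d) {q : ℝ} (hq : 1 ≤ q) :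
    ENNReal.ofReal (truncatedGaussianMoment q ^ 2 * (d : ℝ) ^ (2 / q)) ≤
      ∫⁻ p, ENNReal.ofReal (lqNorm q (p.1 - p.2) ^ 2)
        ∂((stdGaussianPi d).prod (stdGaussianPi d)) := by
  have hd' : (0 : ℝ) < d := by exact_mod_cast hd
  set κ := truncatedGaussianMoment q with hκ
  set P := (stdGaussianPi d).prod (stdGaussianPi d)
  let b : (Fin d → ℝ) × (Fin d → ℝ) → ℝ := fun p => (∑ i, min (|p.1 i - p.2 i| ^ q) 1) / d
  have hint_i : ∀ i : Fin d, Integrable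
      (fun p : (Fin d → ℝ) × (Fin d → ℝ) => min (|p.1 i - p.2 i| ^ q) 1) P := fun i =>
    integrable_min_abs_rpow_one (by fun_prop) q
  have hval : ∀ i : Fin d, ∫ p, min (|p.1 i - p.2 i| ^ q) 1 ∂P = κ := fun i => by
    have h := (measurePreserving_eval_stdGaussianPi i).prod
      (measurePreserving_eval_stdGaussianPi i)
    rw [hκ, truncatedGaussianMoment, ← h.map_eq, integral_map h.aemeasurable
      (Measurable.aestronglyMeasurable (by fun_prop))]
    rfl
  have hb : Integrable b P :=
    (integrable_finsetSum Finset.univ fun i _ => hint_i i).div_const (d : ℝ)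
  have hbmean : ∫ p, b p ∂P = κ := by
    simp only [b]
    rw [integral_div, integral_finsetSum _ fun i _ => hint_i i]
    simp only [hval, Finset.sum_const, Finset.card_univ, Fintype.card_fin, nsmul_eq_mul]
    field_simp
  have hlin : ∫ p, (d : ℝ) ^ (2 / q) * (2 * κ * b p - κ ^ 2) ∂P =
      κ ^ 2 * (d : ℝ) ^ (2 / q) := by
    rw [integral_const_mul, integral_sub (hb.const_mul _) (integrable_const _),
      integral_const_mul, hbmean]
    simp only [integral_const, probReal_univ, smul_eq_mul]
    ring
  have hpt : ∀ p, (d : ℝ) ^ (2 / q) * (2 * κ * b p - κ ^ 2) ≤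
      lqNorm q (p.1 - p.2) ^ 2 := fun p => by
    refine le_trans ?_ (le_lqNorm_sq hd hq (p.1 - p.2))
    gcongr
    change 2 * κ * b p - κ ^ 2 ≤ b p ^ 2
    linarith [sq_nonneg (b p - κ)]
  rw [← hlin]
  exact (ofReal_integral_le_lintegral_ofReal
    (((hb.const_mul _).sub (integrable_const _)).const_mul _)).trans
    (lintegral_mono fun p => ENNReal.ofReal_le_ofReal (hpt p))

/-- The Bayes risk under a prior equal to the noise distribution is bounded below by
exchanging the parameter with the noise. -/
theorem lintegral_lqNorm_sub_sq_le_bayesRisk {d : ℕ} {q : ℝ} (hq : 1 ≤ q)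
    (μ : Measure (Fin d → ℝ)) [SFinite μ] {est : (Fin d → ℝ) → (Fin d → ℝ)}
    (hest : Measurable est) :
    ∫⁻ p, ENNReal.ofReal (lqNorm q (p.1 - p.2) ^ 2) ∂(μ.prod μ) ≤
      4 * ∫⁻ θ, ∫⁻ z, ENNReal.ofReal (lqNorm q (est (θ + z) - θ) ^ 2) ∂μ ∂μ := by
  let F : (Fin d → ℝ) × (Fin d → ℝ) → ℝ≥0∞ := fun p =>
    ENNReal.ofReal (lqNorm q (est (p.1 + p.2) - p.1) ^ 2)
  have hF : Measurable F :=
    (((measurable_lqNorm q).comp (by fun_prop)).pow_const 2).ennreal_ofReal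
  have hswap : ∫⁻ p, F p.swap ∂(μ.prod μ) = ∫⁻ p, F p ∂(μ.prod μ) :=
    lintegral_prod_swap F
  have hpt : ∀ p : (Fin d → ℝ) × (Fin d → ℝ),
      ENNReal.ofReal (lqNorm q (p.1 - p.2) ^ 2) ≤ 2 * (F p.swap + F p) := fun p => by
    have h := lqNorm_sub_sq_le hq (est (p.1 + p.2) - p.2) (est (p.1 + p.2) - p.1)
    rw [sub_sub_sub_cancel_left] at h
    refine (ENNReal.ofReal_le_ofReal h).trans_eq ?_
    rw [ENNReal.ofReal_mul zero_le_two, ENNReal.ofReal_add (sq_nonneg _) (sq_nonneg _)]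
    simp [F, add_comm p.2 p.1]
  calc ∫⁻ p, ENNReal.ofReal (lqNorm q (p.1 - p.2) ^ 2) ∂(μ.prod μ)
      ≤ ∫⁻ p, 2 * (F p.swap + F p) ∂(μ.prod μ) := lintegral_mono hpt
    _ = 4 * ∫⁻ p, F p ∂(μ.prod μ) := by
      rw [lintegral_const_mul _ (by fun_prop),
        lintegral_add_right _ hF, hswap, ← two_mul, ← mul_assoc]
      norm_num
    _ = _ := by rw [lintegral_prod _ hF.aemeasurable]

/-- Minimax rate in the Gaussian sequence model under squared `ℓ_q`
loss: for fixed `q ∈ (1, ∞)` there are constants `c_q, C_q > 0` such that for every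
`d ≥ 1` the minimax risk in the Gaussian location model under the squared `ℓ_q` norm
is of order `d^{2/q}`. -/
theorem gaussian_sequence_minimax_lq (q : ℝ) (hq : 1 < q) :
    ∃ c C : ℝ, 0 < c ∧ 0 < C ∧
      ∀ (d : ℕ), 1 ≤ d →
        -- minimax lower bound
        ((∀ est : (Fin d → ℝ) → (Fin d → ℝ), Measurable est →
          ∃ θ : Fin d → ℝ,
            ENNReal.ofReal (c * (d : ℝ) ^ (2 / q))
              ≤ ∫⁻ z, ENNReal.ofReal (lqNorm q (est (θ + z) - θ) ^ 2) ∂(stdGaussianPi d)) ∧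
        -- minimax upper bound
        (∃ est : (Fin d → ℝ) → (Fin d → ℝ), Measurable est ∧
          ∀ θ : Fin d → ℝ,
            (∫⁻ z, ENNReal.ofReal (lqNorm q (est (θ + z) - θ) ^ 2) ∂(stdGaussianPi d))
              ≤ ENNReal.ofReal (C * (d : ℝ) ^ (2 / q)))) := by
  have hκ := truncatedGaussianMoment_pos q
  set κ := truncatedGaussianMoment q
  refine ⟨κ ^ 2 / 8, 1 + ∫ x, |x| ^ (2 * q) ∂(gaussianReal 0 1), by positivity,
    by positivity, fun d hd => ⟨fun est hest => ?_, id, measurable_id, fun θ => ?_⟩⟩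
  · have hd' : (0 : ℝ) < d := by exact_mod_cast hd
    by_contra! hlt
    have hrisk := (le_lintegral_lqNorm_sub_sq hd hq.le).trans
      (lintegral_lqNorm_sub_sq_le_bayesRisk hq.le (stdGaussianPi d) hest)
    have hle : 4 * ∫⁻ θ, ∫⁻ z, ENNReal.ofReal (lqNorm q (est (θ + z) - θ) ^ 2)
        ∂(stdGaussianPi d) ∂(stdGaussianPi d) ≤
        ENNReal.ofReal (4 * (κ ^ 2 / 8 * (d : ℝ) ^ (2 / q))) := by
      rw [ENNReal.ofReal_mul (by norm_num), ENNReal.ofReal_ofNat]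
      gcongr
      exact (lintegral_mono fun θ => (hlt θ).le).trans_eq (by simp)
    have hreal := (ENNReal.ofReal_le_ofReal_iff (by positivity)).1 (hrisk.trans hle)
    have : 0 < κ ^ 2 * (d : ℝ) ^ (2 / q) := by positivity
    linarith
  · simpa using lintegral_lqNorm_sq_stdGaussianPi_le hd hq.le
end

section
/- (Minimax rate for unconstrained Gaussian mean matrix estimation under all unitarily invariant norms) There exist universal constants c, C > 0 such that the following holds for all integers k, s ≥ 1 and every unitarily invariant norm ‖·‖ on the space of k×s real matrices. Consider the model Y = M + Z where M ∈ ℝ^{k×s} is unknown and Z is a k×s random matrix with i.i.d. N(0,1) entries (its law is the product over entries of the standard Gaussian measure). Then c · max(k, s) · ‖I_r‖² ≤ inf_{M̂} sup_{M ∈ ℝ^{k×s}} E[ ‖M̂(M + Z) − M‖² ] ≤ C · max(k, s) · ‖I_r‖², where the infimum is over all measurable maps M̂ : ℝ^{k×s} → ℝ^{k×s}, r = min(k, s), and I_r ∈ ℝ^{k×s} is the matrix with ones in the entries (i, i) for 1 ≤ i ≤ r and zeros elsewhere. -/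
open MeasureTheory ProbabilityTheory Matrix
open scoped ENNReal

instance matrixMeasurableSpace {k s : ℕ} : MeasurableSpace (Matrix (Fin k) (Fin s) ℝ) :=
  MeasurableSpace.pi

/-- The law of a `k × s` random matrix with i.i.d. standard Gaussian entries. -/
noncomputable def stdGaussianMatrix (k s : ℕ) : Measure (Matrix (Fin k) (Fin s) ℝ) :=
  Measure.pi fun _ : Fin k => Measure.pi fun _ : Fin s => gaussianReal 0 1

/-- `nrm` is a norm on the space of `k × s` real matrices. -/
def IsMatrixNorm {k s : ℕ} (nrm : Matrix (Fin k) (Fin s) ℝ → ℝ) : Prop :=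
  (∀ A B, nrm (A + B) ≤ nrm A + nrm B) ∧
  (∀ (c : ℝ) A, nrm (c • A) = |c| * nrm A) ∧
  (∀ A, nrm A = 0 → A = 0)

/-- `nrm` is invariant under left and right multiplication by orthogonal matrices. -/
def IsUnitarilyInvariant {k s : ℕ} (nrm : Matrix (Fin k) (Fin s) ℝ → ℝ) : Prop :=
  ∀ (U : Matrix (Fin k) (Fin k) ℝ) (V : Matrix (Fin s) (Fin s) ℝ)
    (A : Matrix (Fin k) (Fin s) ℝ), U * Uᵀ = 1 → V * Vᵀ = 1 → nrm (U * A * V) = nrm A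

/-- The `k × s` matrix with ones in the entries `(i, i)` for `i < r` and zeros elsewhere. -/
def Imat (k s r : ℕ) : Matrix (Fin k) (Fin s) ℝ :=
  Matrix.of fun i j => if (i : ℕ) = (j : ℕ) ∧ (i : ℕ) < r then 1 else 0

/-- The `k × s` matrix with the entries of `σ` on its main diagonal and zeros elsewhere. -/
def rectDiagonal (k s : ℕ) (σ : ℕ → ℝ) : Matrix (Fin k) (Fin s) ℝ :=
  Matrix.of fun i j => if (i : ℕ) = (j : ℕ) then σ i else 0

theorem rectDiagonal_congr {k s : ℕ} {σ τ : ℕ → ℝ} (h : ∀ i < min k s, σ i = τ i) :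
    rectDiagonal k s σ = rectDiagonal k s τ := by
  ext i j
  simp only [rectDiagonal, Matrix.of_apply]
  split_ifs with hij
  · exact h _ (lt_min i.2 (hij ▸ j.2))
  · rfl

theorem rectDiagonal_one (k s : ℕ) : rectDiagonal k s (fun _ => 1) = Imat k s (min k s) := by
  ext i j
  simp only [rectDiagonal, Imat, Matrix.of_apply]
  refine if_congr ⟨fun h => ⟨h, lt_min i.2 (h ▸ j.2)⟩, fun h => h.1⟩ rfl rfl

theorem rectDiagonal_add (k s : ℕ) (σ τ : ℕ → ℝ) :
    rectDiagonal k s (σ + τ) = rectDiagonal k s σ + rectDiagonal k s τ := by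
  ext i j
  simp only [rectDiagonal, Matrix.of_apply, Matrix.add_apply, Pi.add_apply]
  split_ifs <;> simp

theorem rectDiagonal_smul (k s : ℕ) (a : ℝ) (σ : ℕ → ℝ) :
    rectDiagonal k s (a • σ) = a • rectDiagonal k s σ := by
  ext i j
  simp [rectDiagonal]

theorem transpose_rectDiagonal (k s : ℕ) (σ : ℕ → ℝ) :
    (rectDiagonal k s σ)ᵀ = rectDiagonal s k σ := by
  ext i j
  simp only [rectDiagonal, Matrix.of_apply, Matrix.transpose_apply]
  by_cases h : (i : ℕ) = j
  · simp [h]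
  · simp [h, Ne.symm h]

/-- Singular value decomposition of a wide matrix, up to the signs of the singular values. -/
theorem exists_svd_of_le {k s : ℕ} (hks : k ≤ s) (A : Matrix (Fin k) (Fin s) ℝ) :
    ∃ (U : Matrix (Fin k) (Fin k) ℝ) (V : Matrix (Fin s) (Fin s) ℝ) (σ : ℕ → ℝ),
      U * Uᵀ = 1 ∧ V * Vᵀ = 1 ∧ (∀ i, 0 ≤ σ i) ∧ A = U * rectDiagonal k s σ * V := by
  have hH : (A * Aᵀ).IsHermitian := by
    simp [Matrix.IsHermitian, Matrix.conjTranspose_eq_transpose_of_trivial]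
  set U : Matrix (Fin k) (Fin k) ℝ := hH.eigenvectorUnitary.1 with hU
  have hUU : U * Uᵀ = 1 := by
    have := Matrix.mem_unitaryGroup_iff.1 hH.eigenvectorUnitary.2
    simpa [Matrix.star_eq_conjTranspose, Matrix.conjTranspose_eq_transpose_of_trivial] using this
  have hUU' : Uᵀ * U = 1 := mul_eq_one_comm.1 hUU
  set B := Uᵀ * A with hB
  have hBB : B * Bᵀ = Matrix.diagonal hH.eigenvalues := by
    have h := hH.spectral_theorem
    rw [Unitary.conjStarAlgAut_apply] at h
    simp only [Matrix.star_eq_conjTranspose,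
      Matrix.conjTranspose_eq_transpose_of_trivial] at h
    have h1 : B * Bᵀ = Uᵀ * (A * Aᵀ) * U := by
      simp only [hB, Matrix.transpose_mul, Matrix.transpose_transpose, Matrix.mul_assoc]
    rw [h1]
    calc Uᵀ * (A * Aᵀ) * U
        = Uᵀ * (U * Matrix.diagonal (RCLike.ofReal ∘ hH.eigenvalues) * Uᵀ) * U :=
          congrArg (fun X => Uᵀ * X * U) h
      _ = (Uᵀ * U) * Matrix.diagonal (RCLike.ofReal ∘ hH.eigenvalues) * (Uᵀ * U) := by
          simp only [Matrix.mul_assoc]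
      _ = Matrix.diagonal hH.eigenvalues := by
          rw [hUU', Matrix.one_mul, Matrix.mul_one]; rfl
  set d := hH.eigenvalues with hd
  have hdot : ∀ i j, ∑ l, B i l * B j l = if i = j then d i else 0 := by
    intro i j
    have := congrFun (congrFun hBB i) j
    simpa [Matrix.mul_apply, Matrix.diagonal_apply] using this
  have hd0 : ∀ i, 0 ≤ d i := by
    intro i
    have := hdot i i
    rw [if_pos rfl] at this
    rw [← this]
    exact Finset.sum_nonneg fun l _ => mul_self_nonneg _
  let σ : ℕ → ℝ := fun i => if h : i < k then √(d ⟨i, h⟩) else 0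
  have hσ : ∀ i : Fin k, σ i = √(d i) := fun i => by simp [σ]
  let v : Fin s → EuclideanSpace ℝ (Fin s) := fun i =>
    if h : (i : ℕ) < k then WithLp.toLp 2 (fun l => (√(d ⟨i, h⟩))⁻¹ * B ⟨i, h⟩ l) else 0
  let S : Set (Fin s) := {i | ∃ h : (i : ℕ) < k, d ⟨i, h⟩ ≠ 0}
  have hv : Orthonormal ℝ (S.domRestrict v) := by
    rw [orthonormal_iff_ite]
    rintro ⟨i, hi, hi0⟩ ⟨j, hj, hj0⟩
    have hsq : √(d ⟨i, hi⟩) ≠ 0 := (Real.sqrt_pos.2 ((hd0 _).lt_of_ne' hi0)).ne'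
    have h1 : inner ℝ (v i) (v j)
        = (√(d ⟨i, hi⟩))⁻¹ * (√(d ⟨j, hj⟩))⁻¹ * ∑ l, B ⟨i, hi⟩ l * B ⟨j, hj⟩ l := by
      simp only [v, dif_pos hi, dif_pos hj, PiLp.inner_apply, Finset.mul_sum]
      refine Finset.sum_congr rfl fun l _ => ?_
      simp
      ring
    change inner ℝ (v i) (v j) = _
    rw [h1, hdot]
    by_cases hij : i = j
    · subst hij
      simp only [if_true]
      have := Real.mul_self_sqrt (hd0 ⟨i, hi⟩)
      nth_rewrite 3 [← this]
      field_simp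
    · have : (⟨i, hi⟩ : Fin k) ≠ ⟨j, hj⟩ := by
        intro h
        exact hij (Fin.ext (by simpa using h))
      simp [hij, this]
  obtain ⟨b, hb⟩ := hv.exists_orthonormalBasis_extension_of_card_eq (by simp)
  let V : Matrix (Fin s) (Fin s) ℝ := Matrix.of fun i j => b i j
  have hVV : V * Vᵀ = 1 := by
    ext i j
    have := orthonormal_iff_ite.1 b.orthonormal i j
    simp only [PiLp.inner_apply] at this
    simp only [Matrix.mul_apply, Matrix.transpose_apply, V, Matrix.of_apply, Matrix.one_apply]
    exact (Finset.sum_congr rfl fun l _ => mul_comm _ _).trans this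
  refine ⟨U, V, σ, hUU, hVV, fun i => ?_, ?_⟩
  · simp only [σ]
    split_ifs
    · exact Real.sqrt_nonneg _
    · exact le_rfl
  have hBV : B = rectDiagonal k s σ * V := by
    ext i j
    have hi : (i : ℕ) < s := i.2.trans_le hks
    rw [Matrix.mul_apply, Finset.sum_eq_single (⟨i, hi⟩ : Fin s)]
    · simp only [rectDiagonal, Matrix.of_apply, if_true, hσ, V]
      by_cases h0 : d i = 0
      · rw [h0, Real.sqrt_zero, zero_mul]
        have h2 := hdot i i
        rw [if_pos rfl, h0, Finset.sum_eq_zero_iff_of_nonneg fun l _ => mul_self_nonneg _] at h2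
        exact mul_self_eq_zero.1 (h2 j (Finset.mem_univ _))
      · rw [hb ⟨i, hi⟩ ⟨i.2, h0⟩]
        have hsq : √(d i) ≠ 0 := (Real.sqrt_pos.2 ((hd0 _).lt_of_ne' h0)).ne'
        simp only [v, dif_pos i.2]
        rw [mul_inv_cancel_left₀ hsq]
    · intro l _ hl
      have : (i : ℕ) ≠ l := fun h => hl (Fin.ext h.symm)
      simp [rectDiagonal, this]
    · simp
  rw [Matrix.mul_assoc, ← hBV, hB, ← Matrix.mul_assoc, hUU, Matrix.one_mul]

/-- Singular value decomposition. -/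
theorem exists_svd {k s : ℕ} (A : Matrix (Fin k) (Fin s) ℝ) :
    ∃ (U : Matrix (Fin k) (Fin k) ℝ) (V : Matrix (Fin s) (Fin s) ℝ) (σ : ℕ → ℝ),
      U * Uᵀ = 1 ∧ V * Vᵀ = 1 ∧ (∀ i, 0 ≤ σ i) ∧ A = U * rectDiagonal k s σ * V := by
  rcases le_total k s with h | h
  · exact exists_svd_of_le h A
  · obtain ⟨U, V, σ, hU, hV, hσ, hA⟩ := exists_svd_of_le h Aᵀ
    refine ⟨Vᵀ, Uᵀ, σ, ?_, ?_, hσ, ?_⟩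
    · rw [Matrix.transpose_transpose]; exact mul_eq_one_comm.1 hV
    · rw [Matrix.transpose_transpose]; exact mul_eq_one_comm.1 hU
    · rw [← Matrix.transpose_transpose A, hA, Matrix.transpose_mul, Matrix.transpose_mul,
        transpose_rectDiagonal, Matrix.mul_assoc]

section UnitarilyInvariant

variable {k s : ℕ} {nrm : Matrix (Fin k) (Fin s) ℝ → ℝ}

theorem IsMatrixNorm.map_zero (hn : IsMatrixNorm nrm) : nrm 0 = 0 := by
  simpa using hn.2.1 0 0

theorem IsMatrixNorm.map_neg (hn : IsMatrixNorm nrm) (A : Matrix (Fin k) (Fin s) ℝ) :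
    nrm (-A) = nrm A := by
  simpa using hn.2.1 (-1) A

theorem IsMatrixNorm.nonneg (hn : IsMatrixNorm nrm) (A : Matrix (Fin k) (Fin s) ℝ) :
    0 ≤ nrm A := by
  have h := hn.1 A (-A)
  rw [add_neg_cancel, hn.map_zero, hn.map_neg] at h
  linarith

theorem IsMatrixNorm.map_sum_le (hn : IsMatrixNorm nrm) {ι : Type*} (t : Finset ι)
    (f : ι → Matrix (Fin k) (Fin s) ℝ) : nrm (∑ i ∈ t, f i) ≤ ∑ i ∈ t, nrm (f i) :=
  Finset.le_sum_of_subadditive _ hn.map_zero.le hn.1 _ _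

theorem IsMatrixNorm.Imat_pos (hn : IsMatrixNorm nrm) (hk : 1 ≤ k) (hs : 1 ≤ s) :
    0 < nrm (Imat k s (min k s)) := by
  refine (hn.nonneg _).lt_of_ne' fun h => ?_
  have := congrFun (congrFun (hn.2.2 _ h) ⟨0, hk⟩) ⟨0, hs⟩
  simp [Imat] at this
  omega

theorem IsMatrixNorm.measurable (hn : IsMatrixNorm nrm) : Measurable nrm := by
  have hconv : ConvexOn ℝ Set.univ (fun A : Fin k → Fin s → ℝ => nrm A) := by
    refine ⟨convex_univ, fun A _ B _ a b ha hb _ => ?_⟩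
    refine (hn.1 _ _).trans (le_of_eq ?_)
    have h1 := hn.2.1 a A
    have h2 := hn.2.1 b B
    rw [abs_of_nonneg ha] at h1
    rw [abs_of_nonneg hb] at h2
    exact congrArg₂ (· + ·) h1 h2
  have : Continuous (fun A : Fin k → Fin s → ℝ => nrm A) :=
    continuousOn_univ.1 (hconv.continuousOn isOpen_univ)
  exact this.measurable

theorem IsUnitarilyInvariant.map_submatrix (hu : IsUnitarilyInvariant nrm)
    (e : Equiv.Perm (Fin k)) (f : Equiv.Perm (Fin s)) (A : Matrix (Fin k) (Fin s) ℝ) :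
    nrm (A.submatrix e f) = nrm A := by
  have orth : ∀ {n : ℕ} (e : Equiv.Perm (Fin n)),
      (1 : Matrix (Fin n) (Fin n) ℝ).submatrix e id *
        ((1 : Matrix (Fin n) (Fin n) ℝ).submatrix e id)ᵀ = 1 := by
    intro n e
    ext i j
    simp [Matrix.mul_apply, Matrix.one_apply, eq_comm]
  have orth' : ∀ {n : ℕ} (e : Equiv.Perm (Fin n)),
      (1 : Matrix (Fin n) (Fin n) ℝ).submatrix id e *
        ((1 : Matrix (Fin n) (Fin n) ℝ).submatrix id e)ᵀ = 1 := fun e => by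
    have := mul_eq_one_comm.1 (orth e)
    simpa only [Matrix.transpose_submatrix, Matrix.transpose_one, Matrix.transpose_transpose] using this
  rw [← hu _ _ A (orth e) (orth' f)]
  congr 1
  ext i j
  simp [Matrix.mul_apply, Matrix.one_apply]

theorem IsUnitarilyInvariant.map_rectDiagonal_sign (hu : IsUnitarilyInvariant nrm)
    {ε : ℕ → ℝ} (hε : ∀ i, ε i = 1 ∨ ε i = -1) :
    nrm (rectDiagonal k s ε) = nrm (Imat k s (min k s)) := by
  rw [← rectDiagonal_one, ← hu (Matrix.diagonal fun i : Fin k => ε i) 1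
    (rectDiagonal k s fun _ => 1) ?_ (by simp)]
  · congr 1
    ext i j
    simp [rectDiagonal, Matrix.diagonal_mul]
  · rw [Matrix.diagonal_transpose, Matrix.diagonal_mul_diagonal, ← Matrix.diagonal_one]
    congr 1
    ext i
    rcases hε i with h | h <;> simp [h]

/-- Among diagonal matrices with entries in `[-1, 1]`, a unitarily invariant norm is largest at
the identity. -/
theorem IsUnitarilyInvariant.map_rectDiagonal_le (hn : IsMatrixNorm nrm)
    (hu : IsUnitarilyInvariant nrm) {σ : ℕ → ℝ} (hσ : ∀ i < min k s, |σ i| ≤ 1) :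
    nrm (rectDiagonal k s σ) ≤ nrm (Imat k s (min k s)) := by
  have key : ∀ m : ℕ, ∀ σ : ℕ → ℝ, (∀ i < m, |σ i| ≤ 1) →
      (∀ i, m ≤ i → σ i = 1 ∨ σ i = -1) →
      nrm (rectDiagonal k s σ) ≤ nrm (Imat k s (min k s)) := by
    intro m
    induction m with
    | zero => exact fun σ _ h => (hu.map_rectDiagonal_sign fun i => h i (Nat.zero_le _)).le
    | succ m ih =>
      intro σ h1 h2
      have hm := abs_le.1 (h1 m (Nat.lt_succ_self m))
      have hup : ∀ a : ℝ, (a = 1 ∨ a = -1) →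
          nrm (rectDiagonal k s (Function.update σ m a)) ≤ nrm (Imat k s (min k s)) := by
        intro a ha
        refine ih _ (fun i hi => ?_) (fun i hi => ?_)
        · rw [Function.update_of_ne hi.ne]; exact h1 i (by omega)
        · rcases eq_or_ne i m with rfl | hne
          · simpa using ha
          · rw [Function.update_of_ne hne]; exact h2 i (by omega)
      have hdec : σ = ((1 + σ m) / 2) • Function.update σ m 1
          + ((1 - σ m) / 2) • Function.update σ m (-1) := by
        ext i
        rcases eq_or_ne i m with rfl | hne
        · simp; ring
        · simp [Function.update_of_ne hne]; ring
      rw [hdec, rectDiagonal_add, rectDiagonal_smul, rectDiagonal_smul]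
      refine (hn.1 _ _).trans ?_
      rw [hn.2.1, hn.2.1, abs_of_nonneg (by linarith), abs_of_nonneg (by linarith)]
      have e1 := mul_le_mul_of_nonneg_left (hup 1 (Or.inl rfl))
        (show 0 ≤ (1 + σ m) / 2 by linarith)
      have e2 := mul_le_mul_of_nonneg_left (hup (-1) (Or.inr rfl))
        (show 0 ≤ (1 - σ m) / 2 by linarith)
      linarith
  have := key (min k s) (fun i => if i < min k s then σ i else 1)
    (fun i hi => by simpa only [if_pos hi] using hσ i hi) (fun i hi => by simp [not_lt.2 hi])
  rwa [rectDiagonal_congr (τ := σ) fun i hi => if_pos hi] at this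

/-- Averaging over cyclic permutations of the diagonal bounds a unitarily invariant norm from
below by a multiple of the nuclear norm. -/
theorem IsUnitarilyInvariant.sum_mul_le (hn : IsMatrixNorm nrm) (hu : IsUnitarilyInvariant nrm)
    (σ : ℕ → ℝ) :
    (∑ i ∈ Finset.range (min k s), σ i) * nrm (Imat k s (min k s))
      ≤ (min k s : ℕ) * nrm (rectDiagonal k s σ) := by
  rcases Nat.eq_zero_or_pos (min k s) with h0 | hpos
  · simp [h0]
  obtain ⟨r, hr⟩ : ∃ r, r = min k s := ⟨_, rfl⟩
  rw [← hr] at hpos ⊢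
  have hrk : r ≤ k := hr ▸ min_le_left _ _
  have hrs : r ≤ s := hr ▸ min_le_right _ _
  have : NeZero r := ⟨hpos.ne'⟩
  let τ : Fin r → ℕ → ℕ := fun t i => if h : i < r then ((⟨i, h⟩ + t : Fin r) : ℕ) else i
  have hτinj : ∀ t i j, τ t i = τ t j → i = j := by
    intro t i j h
    simp only [τ] at h
    split_ifs at h with hi hj hj
    · simpa using Fin.ext h
    · exact absurd (h ▸ Fin.is_lt _) hj
    · exact absurd (h ▸ Fin.is_lt _) hi
    · exact h
  have hext : ∀ {n : ℕ} (hrn : r ≤ n) (t : Fin r), ∃ e : Equiv.Perm (Fin n),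
      ∀ i, (e i : ℕ) = τ t i := by
    intro n hrn t
    let f : Fin n → Fin n := fun i => ⟨τ t i, by
      simp only [τ]
      split_ifs
      · exact (Fin.is_lt _).trans_le hrn
      · exact i.2⟩
    have hf : Function.Injective f := fun i j h =>
      Fin.ext (hτinj t _ _ (congrArg Fin.val h))
    exact ⟨Equiv.ofBijective f (Finite.injective_iff_bijective.1 hf), fun i => rfl⟩
  have hinv : ∀ t, nrm (rectDiagonal k s (σ ∘ τ t)) = nrm (rectDiagonal k s σ) := by
    intro t
    obtain ⟨e, he⟩ := hext hrk t
    obtain ⟨f, hf⟩ := hext hrs t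
    rw [← hu.map_submatrix e f (rectDiagonal k s σ)]
    congr 1
    ext i j
    simp only [rectDiagonal, Matrix.of_apply, Matrix.submatrix_apply, he, hf, Function.comp]
    exact if_congr ⟨fun h => by rw [h], fun h => hτinj t _ _ h⟩ rfl rfl
  have hsum : ∑ t, rectDiagonal k s (σ ∘ τ t)
      = (∑ i ∈ Finset.range r, σ i) • Imat k s r := by
    ext i j
    rw [Matrix.sum_apply, Matrix.smul_apply]
    simp only [rectDiagonal, Imat, Matrix.of_apply, Function.comp]
    by_cases hij : (i : ℕ) = j
    · have hi : (i : ℕ) < r := hr ▸ lt_min i.2 (hij ▸ j.2)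
      simp only [hij, if_true] at hi ⊢
      simp only [hi, and_self, if_true, smul_eq_mul, mul_one, τ, dif_pos]
      rw [← Fin.sum_univ_eq_sum_range]
      exact Equiv.sum_comp (Equiv.addLeft (⟨j, hi⟩ : Fin r)) (fun x : Fin r => σ x)
    · simp [hij]
  calc (∑ i ∈ Finset.range r, σ i) * nrm (Imat k s r)
      ≤ |∑ i ∈ Finset.range r, σ i| * nrm (Imat k s r) :=
        mul_le_mul_of_nonneg_right (le_abs_self _) (hn.nonneg _)
    _ = nrm (∑ t, rectDiagonal k s (σ ∘ τ t)) := by rw [hsum, hn.2.1]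
    _ ≤ ∑ t, nrm (rectDiagonal k s (σ ∘ τ t)) := hn.map_sum_le _ _
    _ = r * nrm (rectDiagonal k s σ) := by simp [hinv]

/-- If `L` bounds the bilinear form of `U * Σ * V` on unit vectors, it bounds the singular
values. -/
theorem singularValue_le {A : Matrix (Fin k) (Fin s) ℝ} {L : ℝ}
    (hL : ∀ u v, u ⬝ᵥ u ≤ 1 → v ⬝ᵥ v ≤ 1 → u ⬝ᵥ A *ᵥ v ≤ L)
    {U : Matrix (Fin k) (Fin k) ℝ} {V : Matrix (Fin s) (Fin s) ℝ} {σ : ℕ → ℝ}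
    (hU : U * Uᵀ = 1) (hV : V * Vᵀ = 1) (hA : A = U * rectDiagonal k s σ * V)
    {i : ℕ} (hi : i < min k s) : σ i ≤ L := by
  have hik : i < k := hi.trans_le (min_le_left _ _)
  have his : i < s := hi.trans_le (min_le_right _ _)
  have hU' : Uᵀ * U = 1 := mul_eq_one_comm.1 hU
  have h1 := hL (Uᵀ ⟨i, hik⟩) (V ⟨i, his⟩) ?_ ?_
  · have h2 : Uᵀ * A * Vᵀ = rectDiagonal k s σ := by
      calc Uᵀ * A * Vᵀ = (Uᵀ * U) * rectDiagonal k s σ * (V * Vᵀ) := by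
            simp only [hA, Matrix.mul_assoc]
        _ = _ := by rw [hU', hV, Matrix.one_mul, Matrix.mul_one]
    have h3 : Uᵀ ⟨i, hik⟩ ⬝ᵥ A *ᵥ V ⟨i, his⟩ = (Uᵀ * (A * Vᵀ)) ⟨i, hik⟩ ⟨i, his⟩ := rfl
    rw [h3, ← Matrix.mul_assoc, h2] at h1
    simpa [rectDiagonal] using h1
  · exact (congrFun (congrFun hU' ⟨i, hik⟩) ⟨i, hik⟩).le.trans (by simp)
  · exact (congrFun (congrFun hV ⟨i, his⟩) ⟨i, his⟩).le.trans (by simp)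

/-- A unitarily invariant norm is at most the operator norm times the norm of the identity. -/
theorem IsUnitarilyInvariant.le_mul (hn : IsMatrixNorm nrm) (hu : IsUnitarilyInvariant nrm)
    {A : Matrix (Fin k) (Fin s) ℝ} {L : ℝ} (hL0 : 0 < L)
    (hL : ∀ u v, u ⬝ᵥ u ≤ 1 → v ⬝ᵥ v ≤ 1 → u ⬝ᵥ A *ᵥ v ≤ L) :
    nrm A ≤ L * nrm (Imat k s (min k s)) := by
  obtain ⟨U, V, σ, hU, hV, hσ, hA⟩ := exists_svd A
  have h1 : nrm (rectDiagonal k s (L⁻¹ • σ)) ≤ nrm (Imat k s (min k s)) := by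
    refine hu.map_rectDiagonal_le hn fun i hi => ?_
    have := singularValue_le hL hU hV hA hi
    rw [Pi.smul_apply, smul_eq_mul, abs_of_nonneg (mul_nonneg (inv_nonneg.2 hL0.le) (hσ i)),
      inv_mul_le_iff₀ hL0, mul_one]
    exact this
  rw [rectDiagonal_smul, hn.2.1, abs_of_pos (inv_pos.2 hL0), inv_mul_le_iff₀ hL0] at h1
  rwa [hA, hu _ _ _ hU hV]

/-- The squared Frobenius norm is controlled by the product of the operator norm and a
unitarily invariant norm. -/
theorem IsUnitarilyInvariant.mul_frobenius_le (hn : IsMatrixNorm nrm)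
    (hu : IsUnitarilyInvariant nrm) {A : Matrix (Fin k) (Fin s) ℝ} {L : ℝ}
    (hL0 : 0 ≤ L) (hL : ∀ u v, u ⬝ᵥ u ≤ 1 → v ⬝ᵥ v ≤ 1 → u ⬝ᵥ A *ᵥ v ≤ L) :
    nrm (Imat k s (min k s)) * ∑ i, ∑ j, A i j ^ 2 ≤ (min k s : ℕ) * (L * nrm A) := by
  obtain ⟨U, V, σ, hU, hV, hσ, hA⟩ := exists_svd A
  have hU' : Uᵀ * U = 1 := mul_eq_one_comm.1 hU
  have htr : ∀ {n m : ℕ} (B : Matrix (Fin n) (Fin m) ℝ),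
      ∑ i, ∑ j, B i j ^ 2 = Matrix.trace (B * Bᵀ) := by
    intro n m B
    simp [Matrix.trace, Matrix.mul_apply, sq]
  have hF : ∑ i, ∑ j, A i j ^ 2 = ∑ i, ∑ j, (rectDiagonal k s σ) i j ^ 2 := by
    rw [htr, htr, hA]
    calc Matrix.trace (U * rectDiagonal k s σ * V * (U * rectDiagonal k s σ * V)ᵀ)
        = Matrix.trace (U * (rectDiagonal k s σ * (V * Vᵀ) * (rectDiagonal k s σ)ᵀ * Uᵀ)) := by
          simp only [Matrix.transpose_mul, Matrix.mul_assoc]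
      _ = Matrix.trace (rectDiagonal k s σ * (rectDiagonal k s σ)ᵀ) := by
          rw [Matrix.trace_mul_comm, hV, Matrix.mul_assoc _ Uᵀ, hU', Matrix.mul_one,
            Matrix.mul_one]
  have hD : ∑ i, ∑ j, (rectDiagonal k s σ) i j ^ 2
      ≤ L * ∑ i ∈ Finset.range (min k s), σ i := by
    have h1 : ∀ i : Fin k, ∑ j, (rectDiagonal k s σ) i j ^ 2
        = if (i : ℕ) < min k s then σ i ^ 2 else 0 := by
      intro i
      simp only [rectDiagonal, Matrix.of_apply]
      split_ifs with hi
      · rw [Finset.sum_eq_single (⟨i, hi.trans_le (min_le_right _ _)⟩ : Fin s)]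
        · simp
        · intro j _ hj
          rw [if_neg fun h => hj (Fin.ext h.symm)]
          simp
        · simp
      · refine Finset.sum_eq_zero fun j _ => ?_
        rw [if_neg fun h : (i : ℕ) = j => hi (lt_min i.2 (h ▸ j.2))]
        simp
    simp only [h1]
    rw [Fin.sum_univ_eq_sum_range (fun i => if i < min k s then σ i ^ 2 else 0) k,
      ← Finset.sum_filter, Finset.mul_sum]
    have h2 : (Finset.range k).filter (fun i => i < min k s) = Finset.range (min k s) := by
      ext i; simp
    rw [h2]
    refine Finset.sum_le_sum fun i hi => ?_
    rw [sq]
    exact mul_le_mul_of_nonneg_right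
      (singularValue_le hL hU hV hA (Finset.mem_range.1 hi)) (hσ i)
  have hS := hu.sum_mul_le hn σ
  have hnA : nrm A = nrm (rectDiagonal k s σ) := by rw [hA, hu _ _ _ hU hV]
  rw [hF, hnA]
  calc nrm (Imat k s (min k s)) * ∑ i, ∑ j, (rectDiagonal k s σ) i j ^ 2
      ≤ nrm (Imat k s (min k s)) * (L * ∑ i ∈ Finset.range (min k s), σ i) :=
        mul_le_mul_of_nonneg_left hD (hn.nonneg _)
    _ = L * ((∑ i ∈ Finset.range (min k s), σ i) * nrm (Imat k s (min k s))) := by ring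
    _ ≤ L * ((min k s : ℕ) * nrm (rectDiagonal k s σ)) := mul_le_mul_of_nonneg_left hS hL0
    _ = _ := by ring

end UnitarilyInvariant

instance isProbabilityMeasure_stdGaussianMatrix (k s : ℕ) :
    IsProbabilityMeasure (stdGaussianMatrix k s) :=
  inferInstanceAs (IsProbabilityMeasure
    (Measure.pi fun _ : Fin k => Measure.pi fun _ : Fin s => gaussianReal 0 1))

theorem measurable_matrix_entry {k s : ℕ} (i : Fin k) (j : Fin s) :
    Measurable fun z : Matrix (Fin k) (Fin s) ℝ => z i j :=
  (measurable_pi_apply (X := fun _ : Fin s => ℝ) j).comp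
    (measurable_pi_apply (X := fun _ : Fin k => Fin s → ℝ) i)

theorem measurePreserving_neg_stdGaussianMatrix (k s : ℕ) :
    MeasurePreserving (fun z : Matrix (Fin k) (Fin s) ℝ => -z)
      (stdGaussianMatrix k s) (stdGaussianMatrix k s) := by
  have h : MeasurePreserving (fun x : ℝ => -x) (gaussianReal 0 1) (gaussianReal 0 1) :=
    ⟨measurable_neg, by rw [gaussianReal_map_neg, neg_zero]⟩
  exact measurePreserving_pi (fun _ => Measure.pi fun _ => gaussianReal 0 1)
    (fun _ => Measure.pi fun _ => gaussianReal 0 1)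
    fun _ => measurePreserving_pi (fun _ => gaussianReal 0 1) (fun _ => gaussianReal 0 1)
      fun _ => h

theorem lintegral_sum_sq_stdGaussianMatrix (k s : ℕ) :
    ∫⁻ z, ENNReal.ofReal (∑ i, ∑ j, z i j ^ 2) ∂(stdGaussianMatrix k s) = k * s := by
  have hmeas : ∀ (i : Fin k) (j : Fin s),
      Measurable fun z : Matrix (Fin k) (Fin s) ℝ => ENNReal.ofReal (z i j ^ 2) := fun i j =>
    ((measurable_matrix_entry i j).pow_const 2).ennreal_ofReal
  have hone : ∫⁻ x, ENNReal.ofReal (x ^ 2) ∂(gaussianReal 0 1) = 1 := by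
    have h := (evariance_eq_lintegral_ofReal (X := id) (μ := gaussianReal 0 1)).symm
    rw [← (memLp_id_gaussianReal 2).ofReal_variance_eq, variance_id_gaussianReal] at h
    simpa using h
  have hentry : ∀ (i : Fin k) (j : Fin s),
      ∫⁻ z : Matrix (Fin k) (Fin s) ℝ, ENNReal.ofReal (z i j ^ 2) ∂(stdGaussianMatrix k s)
        = 1 := by
    intro i j
    have h1 := measurePreserving_eval
      (fun _ : Fin k => Measure.pi fun _ : Fin s => gaussianReal 0 1) i
    have h2 := measurePreserving_eval (fun _ : Fin s => gaussianReal 0 1) j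
    rw [← hone]
    exact (h2.comp h1).lintegral_comp (f := fun x : ℝ => ENNReal.ofReal (x ^ 2)) (by fun_prop)
  have hexp : ∀ z : Matrix (Fin k) (Fin s) ℝ,
      ENNReal.ofReal (∑ i, ∑ j, z i j ^ 2) = ∑ i, ∑ j, ENNReal.ofReal (z i j ^ 2) := by
    intro z
    refine (ENNReal.ofReal_sum_of_nonneg fun i _ =>
      Finset.sum_nonneg fun j _ => sq_nonneg (z i j)).trans ?_
    exact Finset.sum_congr rfl fun i _ => ENNReal.ofReal_sum_of_nonneg fun j _ => sq_nonneg _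
  simp_rw [hexp]
  rw [lintegral_finsetSum _ fun i _ => Finset.measurable_sum _ fun j _ => hmeas i j]
  simp_rw [lintegral_finsetSum _ fun j _ => hmeas _ j, hentry]
  simp

/-- The Laplace transform of the standard Gaussian matrix. -/
theorem lintegral_exp_stdGaussianMatrix {k s : ℕ} (a : Matrix (Fin k) (Fin s) ℝ) :
    ∫⁻ z, ENNReal.ofReal (Real.exp (∑ i, ∑ j, a i j * z i j)) ∂(stdGaussianMatrix k s)
      = ENNReal.ofReal (Real.exp ((∑ i, ∑ j, a i j ^ 2) / 2)) := by
  have hrow : ∀ i, Integrable (fun x : Fin s → ℝ => ∏ j, Real.exp (a i j * x j))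
      (Measure.pi fun _ : Fin s => gaussianReal 0 1) := fun i =>
    Integrable.fintype_prod fun j => integrable_exp_mul_gaussianReal (a i j)
  have hint : Integrable (fun z : Fin k → Fin s → ℝ => ∏ i, ∏ j, Real.exp (a i j * z i j))
      (Measure.pi fun _ : Fin k => Measure.pi fun _ : Fin s => gaussianReal 0 1) :=
    Integrable.fintype_prod hrow
  have hval : ∫ z : Fin k → Fin s → ℝ, ∏ i, ∏ j, Real.exp (a i j * z i j)
      ∂(Measure.pi fun _ : Fin k => Measure.pi fun _ : Fin s => gaussianReal 0 1)
      = Real.exp ((∑ i, ∑ j, a i j ^ 2) / 2) := by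
    rw [integral_fintype_prod_eq_prod
      (f := fun (i : Fin k) (x : Fin s → ℝ) => ∏ j, Real.exp (a i j * x j))]
    have h1 : ∀ t : ℝ, ∫ x, Real.exp (t * x) ∂(gaussianReal 0 1) = Real.exp (t ^ 2 / 2) := by
      intro t
      have := congrFun (mgf_id_gaussianReal (μ := 0) (v := 1)) t
      simpa [mgf] using this
    have h2 : ∀ i, ∫ x : Fin s → ℝ, ∏ j, Real.exp (a i j * x j)
        ∂(Measure.pi fun _ : Fin s => gaussianReal 0 1) = ∏ j, Real.exp (a i j ^ 2 / 2) := by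
      intro i
      rw [integral_fintype_prod_eq_prod (f := fun (j : Fin s) (x : ℝ) => Real.exp (a i j * x))]
      simp_rw [h1]
    simp_rw [h2, ← Real.exp_sum, Finset.sum_div]
  rw [← hval, ofReal_integral_eq_lintegral_ofReal hint
    (Filter.Eventually.of_forall fun z => by positivity)]
  simp_rw [Real.exp_sum]
  rfl

open scoped Pointwise in
/-- The uniform law on the ball of radius `2` dominates, up to a factor `2 ^ n`, exponentials of
linear forms evaluated at points of the unit ball. -/
theorem exists_exp_smoothing_measure (n : ℕ) :
    ∃ ν : Measure (Fin n → ℝ), IsProbabilityMeasure ν ∧ (∀ᵐ x ∂ν, x ⬝ᵥ x ≤ 4) ∧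
      ∀ a v : Fin n → ℝ, v ⬝ᵥ v ≤ 1 →
        ENNReal.ofReal (Real.exp (a ⬝ᵥ v))
          ≤ 2 ^ n * ∫⁻ x, ENNReal.ofReal (Real.exp (a ⬝ᵥ x)) ∂ν := by
  have hcont : Continuous fun x : Fin n → ℝ => x ⬝ᵥ x := by
    simp only [dotProduct]; fun_prop
  have hcont' : ∀ a : Fin n → ℝ, Continuous fun x : Fin n → ℝ => a ⬝ᵥ x := fun a => by
    simp only [dotProduct]; fun_prop
  let B : Set (Fin n → ℝ) := {x | x ⬝ᵥ x ≤ 1}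
  let S : Set (Fin n → ℝ) := {x | x ⬝ᵥ x ≤ 4}
  have hB : MeasurableSet B := (isClosed_le hcont continuous_const).measurableSet
  have hS : MeasurableSet S := (isClosed_le hcont continuous_const).measurableSet
  have hBfin : volume B ≠ ∞ := by
    have hsub : B ⊆ Set.Icc (fun _ => -1) (fun _ => 1) := by
      intro x hx
      have h : ∀ i, |x i| ≤ 1 := fun i => by
        have h1 : x i * x i ≤ x ⬝ᵥ x :=
          Finset.single_le_sum (f := fun i => x i * x i) (fun i _ => mul_self_nonneg _)
            (Finset.mem_univ i)
        exact abs_le_one_iff_mul_self_le_one.2 (h1.trans hx)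
      exact ⟨fun i => (abs_le.1 (h i)).1, fun i => (abs_le.1 (h i)).2⟩
    exact ((measure_mono hsub).trans_lt isCompact_Icc.measure_lt_top).ne
  have hBpos : volume B ≠ 0 := by
    have hopen : IsOpen {x : Fin n → ℝ | x ⬝ᵥ x < 1} := isOpen_lt hcont continuous_const
    have hne : {x : Fin n → ℝ | x ⬝ᵥ x < 1}.Nonempty := ⟨0, by simp⟩
    exact ((hopen.measure_pos volume hne).trans_le
      (measure_mono fun x (hx : x ⬝ᵥ x < 1) => (hx.le : x ⬝ᵥ x ≤ 1))).ne'
  have hSB : volume S = 2 ^ n * volume B := by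
    have h : S = (2 : ℝ) • B := by
      ext x
      rw [Set.mem_smul_set_iff_inv_smul_mem₀ two_ne_zero]
      simp only [S, B, Set.mem_ofPred_eq, smul_dotProduct, dotProduct_smul, smul_eq_mul]
      constructor <;> intro h <;> linarith
    rw [h, Measure.addHaar_smul]
    simp
  have hSfin : volume S ≠ ∞ := by
    rw [hSB]; exact ENNReal.mul_ne_top (by simp) hBfin
  have hSpos : volume S ≠ 0 := by
    rw [hSB]; exact mul_ne_zero (by simp) hBpos
  refine ⟨(volume S)⁻¹ • volume.restrict S, ⟨?_⟩, ?_, fun a v hv => ?_⟩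
  · simp [ENNReal.inv_mul_cancel hSpos hSfin]
  · exact Measure.ae_smul_measure (ae_restrict_mem hS) _
  let f : (Fin n → ℝ) → ℝ≥0∞ := fun x => ENNReal.ofReal (Real.exp (a ⬝ᵥ x))
  have hf : Measurable f := ((hcont' a).measurable.exp).ennreal_ofReal
  have hI : volume B * f v ≤ ∫⁻ y in B, f (v + y) := by
    have hsymm : ∫⁻ y in B, f (v - y) = ∫⁻ y in B, f (v + y) := by
      rw [← lintegral_indicator hB, ← lintegral_indicator hB, ← lintegral_neg_eq_self]
      refine lintegral_congr fun y => ?_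
      have : -y ∈ B ↔ y ∈ B := by simp [B]
      by_cases hy : y ∈ B
      · rw [Set.indicator_of_mem (this.2 hy), Set.indicator_of_mem hy, sub_neg_eq_add]
      · rw [Set.indicator_of_notMem (fun h => hy (this.1 h)), Set.indicator_of_notMem hy]
    have h2 : 2 * (volume B * f v) ≤ 2 * ∫⁻ y in B, f (v + y) := by
      calc 2 * (volume B * f v) = ∫⁻ _ in B, 2 * f v := by
            rw [setLIntegral_const]; ring
        _ ≤ ∫⁻ y in B, (f (v + y) + f (v - y)) := by
            refine lintegral_mono fun y => ?_
            simp only [f]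
            rw [← ENNReal.ofReal_add (Real.exp_pos _).le (Real.exp_pos _).le,
              ← ENNReal.ofReal_ofNat, ← ENNReal.ofReal_mul (by norm_num)]
            refine ENNReal.ofReal_le_ofReal ?_
            rw [dotProduct_add, dotProduct_sub, Real.exp_add, sub_eq_add_neg, Real.exp_add,
              ← mul_add, mul_comm]
            refine mul_le_mul_of_nonneg_left ?_ (Real.exp_pos _).le
            have := Real.add_one_le_exp (a ⬝ᵥ y)
            have := Real.add_one_le_exp (-(a ⬝ᵥ y))
            linarith
        _ = 2 * ∫⁻ y in B, f (v + y) := by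
            rw [lintegral_add_left (f := fun y => f (v + y)) (hf.comp (measurable_const_add v)),
              hsymm, two_mul]
    exact (ENNReal.mul_le_mul_iff_right two_ne_zero ENNReal.ofNat_ne_top).1 h2
  have hIS : ∫⁻ y in B, f (v + y) ≤ ∫⁻ x in S, f x := by
    rw [← lintegral_indicator hB, ← lintegral_indicator hS,
      ← lintegral_add_left_eq_self (S.indicator f) v]
    refine lintegral_mono fun y => ?_
    by_cases hy : y ∈ B
    · have hvy : v + y ∈ S := by
        have h0 : 0 ≤ (v - y) ⬝ᵥ (v - y) := Finset.sum_nonneg fun i _ => mul_self_nonneg _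
        have hy1 : y ⬝ᵥ y ≤ 1 := hy
        simp only [S, Set.mem_ofPred_eq, add_dotProduct, dotProduct_add]
        simp only [sub_dotProduct, dotProduct_sub] at h0
        linarith
      rw [Set.indicator_of_mem hy, Set.indicator_of_mem hvy]
    · rw [Set.indicator_of_notMem hy]; exact zero_le
  rw [lintegral_smul_measure, hSB, smul_eq_mul]
  change f v ≤ 2 ^ n * ((2 ^ n * volume B)⁻¹ * ∫⁻ x in S, f x)
  rw [ENNReal.mul_inv (Or.inl (by simp)) (Or.inl (by simp)), ← mul_assoc, ← mul_assoc,
    ENNReal.mul_inv_cancel (by simp) (by simp), one_mul]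
  calc f v = (volume B)⁻¹ * (volume B * f v) := by
        rw [← mul_assoc, ENNReal.inv_mul_cancel hBpos hBfin, one_mul]
    _ ≤ _ := mul_le_mul_right (hI.trans hIS) _

theorem sq_max_zero_le_exp {N y : ℝ} (hN : 1 ≤ N) :
    max y 0 ^ 2 ≤ 162 + 4 * (Real.exp (-(9 * N)) * Real.exp (N * y)) := by
  rw [← Real.exp_add]
  rcases le_total y 9 with h | h
  · have : max y 0 ^ 2 ≤ 9 ^ 2 :=
      pow_le_pow_left₀ (le_max_right _ _) (max_le h (by norm_num)) 2
    have := Real.exp_pos (-(9 * N) + N * y)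
    linarith
  · rw [max_eq_left (by linarith)]
    have h1 := Real.quadratic_le_exp_of_nonneg (sub_nonneg.2 h)
    have h2 : Real.exp (y - 9) ≤ Real.exp (-(9 * N) + N * y) :=
      Real.exp_le_exp.2 (by nlinarith)
    nlinarith [sq_nonneg (y - 18)]

/-- The squared operator norm of a standard Gaussian matrix has a measurable upper bound with
expectation of order `max k s`. -/
theorem exists_opNorm_sq_bound {k s : ℕ} (hk : 1 ≤ k) :
    ∃ W : Matrix (Fin k) (Fin s) ℝ → ℝ≥0∞, Measurable W ∧
      ∫⁻ Z, W Z ∂(stdGaussianMatrix k s) ≤ ENNReal.ofReal (332 * max (k : ℝ) s) ∧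
      ∀ Z u v, u ⬝ᵥ u ≤ 1 → v ⬝ᵥ v ≤ 1 → ENNReal.ofReal (u ⬝ᵥ Z *ᵥ v) ^ 2 ≤ W Z := by
  obtain ⟨ν, hν, hν4, hνexp⟩ := exists_exp_smoothing_measure k
  obtain ⟨ρ, hρ, hρ4, hρexp⟩ := exists_exp_smoothing_measure s
  obtain ⟨N, hNdef⟩ : ∃ N : ℝ, N = (k : ℝ) + s := ⟨_, rfl⟩
  have hN : 1 ≤ N := by
    have : (1 : ℝ) ≤ k := by exact_mod_cast hk
    have : (0 : ℝ) ≤ s := by positivity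
    linarith
  have hsqrt : √N * √N = N := Real.mul_self_sqrt (by linarith)
  have hsqrt0 : 0 < √N := Real.sqrt_pos.2 (by linarith)
  let E : Matrix (Fin k) (Fin s) ℝ → (Fin k → ℝ) → (Fin s → ℝ) → ℝ≥0∞ := fun Z u v =>
    ENNReal.ofReal (Real.exp (√N * (u ⬝ᵥ Z *ᵥ v)))
  have hmeas : Measurable fun p : (Matrix (Fin k) (Fin s) ℝ × (Fin k → ℝ)) × (Fin s → ℝ) =>
      E p.1.1 p.1.2 p.2 := by
    have hentry : ∀ i j, Measurable
        fun p : (Matrix (Fin k) (Fin s) ℝ × (Fin k → ℝ)) × (Fin s → ℝ) => p.1.1 i j :=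
      fun i j => (measurable_matrix_entry i j).comp (measurable_fst.comp measurable_fst)
    simp only [E, dotProduct, Matrix.mulVec]
    fun_prop
  let Φ : Matrix (Fin k) (Fin s) ℝ → ℝ≥0∞ := fun Z => ∫⁻ u, ∫⁻ v, E Z u v ∂ρ ∂ν
  have hinner : Measurable fun p : Matrix (Fin k) (Fin s) ℝ × (Fin k → ℝ) =>
      ∫⁻ v, E p.1 p.2 v ∂ρ := hmeas.lintegral_prod_right'
  have hΦ : Measurable Φ := hinner.lintegral_prod_right'
  have hEle : ∀ Z u v, u ⬝ᵥ u ≤ 1 → v ⬝ᵥ v ≤ 1 → E Z u v ≤ 2 ^ (k + s) * Φ Z := by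
    intro Z u v hu hv
    have hstep1 : ∀ u', E Z u' v ≤ 2 ^ s * ∫⁻ v', E Z u' v' ∂ρ := by
      intro u'
      have := hρexp (√N • (u' ᵥ* Z)) v hv
      simpa only [E, smul_dotProduct, Matrix.dotProduct_mulVec, smul_eq_mul] using this
    have hstep2 : E Z u v ≤ 2 ^ k * ∫⁻ u', E Z u' v ∂ν := by
      have := hνexp (√N • (Z *ᵥ v)) u hu
      simpa only [E, smul_dotProduct, dotProduct_comm (Z *ᵥ v), smul_eq_mul] using this
    calc E Z u v ≤ 2 ^ k * ∫⁻ u', E Z u' v ∂ν := hstep2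
      _ ≤ 2 ^ k * ∫⁻ u', 2 ^ s * ∫⁻ v', E Z u' v' ∂ρ ∂ν :=
          mul_le_mul_right (lintegral_mono hstep1) _
      _ = 2 ^ (k + s) * Φ Z := by
          rw [lintegral_const_mul' _ _ (by simp), ← mul_assoc, pow_add]
  have hEint : ∀ u v, u ⬝ᵥ u ≤ 4 → v ⬝ᵥ v ≤ 4 →
      ∫⁻ Z, E Z u v ∂(stdGaussianMatrix k s) ≤ ENNReal.ofReal (Real.exp (8 * N)) := by
    intro u v hu hv
    have h1 := lintegral_exp_stdGaussianMatrix (Matrix.of fun i j => √N * (u i * v j))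
    have h2 : ∀ Z : Matrix (Fin k) (Fin s) ℝ, ∑ i, ∑ j,
        (Matrix.of fun i j => √N * (u i * v j)) i j * Z i j = √N * (u ⬝ᵥ Z *ᵥ v) := by
      intro Z
      simp only [dotProduct, Matrix.mulVec, Finset.mul_sum, Matrix.of_apply]
      exact Finset.sum_congr rfl fun i _ => Finset.sum_congr rfl fun j _ => by ring
    simp only [h2] at h1
    refine h1.le.trans (ENNReal.ofReal_le_ofReal (Real.exp_le_exp.2 ?_))
    have h3 : ∑ i, ∑ j, (Matrix.of fun i j => √N * (u i * v j)) i j ^ 2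
        = N * ((u ⬝ᵥ u) * (v ⬝ᵥ v)) := by
      rw [dotProduct, dotProduct, Finset.sum_mul_sum]
      simp only [Finset.mul_sum, Matrix.of_apply]
      refine Finset.sum_congr rfl fun i _ => Finset.sum_congr rfl fun j _ => ?_
      rw [mul_pow, sq √N, hsqrt]
      ring
    have h4 : (u ⬝ᵥ u) * (v ⬝ᵥ v) ≤ 4 * 4 :=
      mul_le_mul hu hv (Finset.sum_nonneg fun i _ => mul_self_nonneg _) (by norm_num)
    rw [h3]
    nlinarith
  have hΦint : ∫⁻ Z, Φ Z ∂(stdGaussianMatrix k s) ≤ ENNReal.ofReal (Real.exp (8 * N)) := by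
    calc ∫⁻ Z, Φ Z ∂(stdGaussianMatrix k s)
        = ∫⁻ u, ∫⁻ Z, ∫⁻ v, E Z u v ∂ρ ∂(stdGaussianMatrix k s) ∂ν :=
          lintegral_lintegral_swap hinner.aemeasurable
      _ = ∫⁻ u, ∫⁻ v, ∫⁻ Z, E Z u v ∂(stdGaussianMatrix k s) ∂ρ ∂ν := by
          refine lintegral_congr fun u => lintegral_lintegral_swap ?_
          have : Measurable fun q : Matrix (Fin k) (Fin s) ℝ × (Fin s → ℝ) => ((q.1, u), q.2) :=
            by fun_prop
          exact (hmeas.comp this).aemeasurable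
      _ ≤ ∫⁻ _, ∫⁻ _, ENNReal.ofReal (Real.exp (8 * N)) ∂ρ ∂ν := by
          refine lintegral_mono_ae ?_
          filter_upwards [hν4] with u hu
          refine lintegral_mono_ae ?_
          filter_upwards [hρ4] with v hv
          exact hEint u v hu hv
      _ = _ := by simp
  refine ⟨fun Z => ENNReal.ofReal N * (162 + 4 * (ENNReal.ofReal (Real.exp (-(9 * N))) *
    (2 ^ (k + s) * Φ Z))), by fun_prop, ?_, fun Z u v hu hv => ?_⟩
  · have hmass : ENNReal.ofReal (Real.exp (-(9 * N))) *
        (2 ^ (k + s) * ENNReal.ofReal (Real.exp (8 * N))) ≤ 1 := by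
      have h2 : (2 : ℝ≥0∞) ^ (k + s) = ENNReal.ofReal (2 ^ (k + s)) := by
        rw [ENNReal.ofReal_pow (by norm_num), ENNReal.ofReal_ofNat]
      rw [h2, ← ENNReal.ofReal_mul (by positivity), ← ENNReal.ofReal_mul (by positivity),
        ← ENNReal.ofReal_one]
      refine ENNReal.ofReal_le_ofReal ?_
      have h3 : (2 : ℝ) ^ (k + s) ≤ Real.exp N := by
        have h4 : (2 : ℝ) ≤ Real.exp 1 := by have := Real.add_one_le_exp 1; linarith
        refine (pow_le_pow_left₀ (by norm_num) h4 _).trans (le_of_eq ?_)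
        rw [← Real.exp_nat_mul, hNdef]
        push_cast
        ring_nf
      calc Real.exp (-(9 * N)) * (2 ^ (k + s) * Real.exp (8 * N))
          ≤ Real.exp (-(9 * N)) * (Real.exp N * Real.exp (8 * N)) := by gcongr
        _ = 1 := by rw [← Real.exp_add, ← Real.exp_add]; ring_nf; simp
    rw [lintegral_const_mul _ (by fun_prop), lintegral_add_left measurable_const,
      lintegral_const,
      lintegral_const_mul _ (by fun_prop), lintegral_const_mul _ (by fun_prop),
      lintegral_const_mul _ (by fun_prop)]
    calc _ ≤ ENNReal.ofReal N * (162 * 1 + 4 * 1) := by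
          rw [measure_univ]
          gcongr
          refine le_trans ?_ hmass
          gcongr
      _ = ENNReal.ofReal (N * 166) := by
          rw [ENNReal.ofReal_mul (by linarith), ENNReal.ofReal_ofNat]
          norm_num
      _ ≤ _ := by
          refine ENNReal.ofReal_le_ofReal ?_
          have := le_max_left (k : ℝ) s
          have := le_max_right (k : ℝ) s
          linarith
  · have hscal := sq_max_zero_le_exp (y := (u ⬝ᵥ Z *ᵥ v) / √N) hN
    have harg : N * ((u ⬝ᵥ Z *ᵥ v) / √N) = √N * (u ⬝ᵥ Z *ᵥ v) := by
      nth_rewrite 1 [← hsqrt]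
      field_simp
    rw [harg] at hscal
    have hmax : max (u ⬝ᵥ Z *ᵥ v) 0 ^ 2 = N * max ((u ⬝ᵥ Z *ᵥ v) / √N) 0 ^ 2 := by
      have : max (u ⬝ᵥ Z *ᵥ v) 0 = √N * max ((u ⬝ᵥ Z *ᵥ v) / √N) 0 := by
        rw [mul_max_of_nonneg _ _ hsqrt0.le, mul_zero, mul_div_cancel₀ _ hsqrt0.ne']
      rw [this, mul_pow, sq √N, hsqrt]
    calc ENNReal.ofReal (u ⬝ᵥ Z *ᵥ v) ^ 2
        = ENNReal.ofReal (max (u ⬝ᵥ Z *ᵥ v) 0 ^ 2) := by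
          rw [ENNReal.ofReal_pow (le_max_right _ _), ENNReal.ofReal_max, ENNReal.ofReal_zero,
            max_eq_left zero_le]
      _ ≤ ENNReal.ofReal (N * (162 + 4 * (Real.exp (-(9 * N)) *
            Real.exp (√N * (u ⬝ᵥ Z *ᵥ v))))) := by
          rw [hmax]
          exact ENNReal.ofReal_le_ofReal (mul_le_mul_of_nonneg_left hscal (by linarith))
      _ = ENNReal.ofReal N * (162 + 4 * (ENNReal.ofReal (Real.exp (-(9 * N))) * E Z u v)) := by
          rw [ENNReal.ofReal_mul (by linarith), ENNReal.ofReal_add (by norm_num) (by positivity),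
            ENNReal.ofReal_mul (by norm_num), ENNReal.ofReal_mul (by positivity),
            ENNReal.ofReal_ofNat, ENNReal.ofReal_ofNat]
      _ ≤ ENNReal.ofReal N * (162 + 4 * (ENNReal.ofReal (Real.exp (-(9 * N))) *
            (2 ^ (k + s) * Φ Z))) := by
          gcongr
          exact hEle Z u v hu hv

theorem measurable_matrix_add {α : Type*} [MeasurableSpace α] {k s : ℕ}
    {f g : α → Matrix (Fin k) (Fin s) ℝ} (hf : Measurable f) (hg : Measurable g) :
    Measurable fun x => f x + g x :=
  measurable_pi_lambda _ fun i => measurable_pi_lambda _ fun j =>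
    ((measurable_matrix_entry i j).comp hf).add ((measurable_matrix_entry i j).comp hg)

theorem measurable_matrix_sub {α : Type*} [MeasurableSpace α] {k s : ℕ}
    {f g : α → Matrix (Fin k) (Fin s) ℝ} (hf : Measurable f) (hg : Measurable g) :
    Measurable fun x => f x - g x :=
  measurable_pi_lambda _ fun i => measurable_pi_lambda _ fun j =>
    ((measurable_matrix_entry i j).comp hf).sub ((measurable_matrix_entry i j).comp hg)

section Risk

variable {k s : ℕ} {nrm : Matrix (Fin k) (Fin s) ℝ → ℝ}

/-- Passage from an extended real bound on the square of a bilinear form to a real bound. -/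
theorem bilin_le_sqrt_toReal {W : ℝ≥0∞} (hW : W ≠ ∞) {Z : Matrix (Fin k) (Fin s) ℝ}
    (h : ∀ u v, u ⬝ᵥ u ≤ 1 → v ⬝ᵥ v ≤ 1 → ENNReal.ofReal (u ⬝ᵥ Z *ᵥ v) ^ 2 ≤ W) :
    ∀ u v, u ⬝ᵥ u ≤ 1 → v ⬝ᵥ v ≤ 1 → u ⬝ᵥ Z *ᵥ v ≤ √W.toReal := by
  intro u v hu hv
  refine Real.le_sqrt_of_sq_le ?_ |>.trans' (le_max_left _ 0)
  have h1 := ENNReal.toReal_mono hW (h u v hu hv)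
  rwa [ENNReal.toReal_pow, ENNReal.toReal_ofReal'] at h1

/-- The risk of the identity estimator. -/
theorem IsUnitarilyInvariant.lintegral_norm_sq_le (hn : IsMatrixNorm nrm)
    (hu : IsUnitarilyInvariant nrm) (hk : 1 ≤ k) (hs : 1 ≤ s) :
    ∫⁻ z, ENNReal.ofReal (nrm z ^ 2) ∂(stdGaussianMatrix k s)
      ≤ ENNReal.ofReal (332 * max (k : ℝ) s * nrm (Imat k s (min k s)) ^ 2) := by
  obtain ⟨W, hWm, hWint, hW⟩ := exists_opNorm_sq_bound (s := s) hk
  have hb := hn.Imat_pos hk hs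
  have hpt : ∀ z, ENNReal.ofReal (nrm z ^ 2)
      ≤ W z * ENNReal.ofReal (nrm (Imat k s (min k s)) ^ 2) := by
    intro z
    by_cases hz : W z = ∞
    · rw [hz, ENNReal.top_mul (ENNReal.ofReal_pos.2 (pow_pos hb 2)).ne']
      exact le_top
    have hL := bilin_le_sqrt_toReal hz (hW z)
    have h1 : nrm z ≤ √(W z).toReal * nrm (Imat k s (min k s)) := by
      refine le_of_forall_pos_le_add fun ε hε => ?_
      have h2 := hu.le_mul hn (A := z) (L := √(W z).toReal + ε / nrm (Imat k s (min k s)))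
        (by positivity) fun u v hu hv => (hL u v hu hv).trans
          (le_add_of_nonneg_right (by positivity))
      rwa [add_mul, div_mul_cancel₀ _ hb.ne'] at h2
    rw [← ENNReal.ofReal_toReal hz, ← ENNReal.ofReal_mul ENNReal.toReal_nonneg]
    refine ENNReal.ofReal_le_ofReal ?_
    rw [← Real.sq_sqrt (ENNReal.toReal_nonneg (a := W z)), ← mul_pow]
    exact pow_le_pow_left₀ (hn.nonneg _) h1 2
  calc ∫⁻ z, ENNReal.ofReal (nrm z ^ 2) ∂(stdGaussianMatrix k s)
      ≤ ∫⁻ z, W z * ENNReal.ofReal (nrm (Imat k s (min k s)) ^ 2) ∂(stdGaussianMatrix k s) :=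
        lintegral_mono hpt
    _ ≤ ENNReal.ofReal (332 * max (k : ℝ) s)
          * ENNReal.ofReal (nrm (Imat k s (min k s)) ^ 2) := by
        rw [lintegral_mul_const _ hWm]
        gcongr
    _ = _ := by rw [← ENNReal.ofReal_mul (by positivity)]

/-- The expected squared norm of the noise is at least of order `max k s * ‖I_r‖ ^ 2`. -/
theorem IsUnitarilyInvariant.lintegral_norm_sq_ge (hn : IsMatrixNorm nrm)
    (hu : IsUnitarilyInvariant nrm) (hk : 1 ≤ k) (hs : 1 ≤ s) :
    ENNReal.ofReal (1 / 332 * max (k : ℝ) s * nrm (Imat k s (min k s)) ^ 2)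
      ≤ ∫⁻ z, ENNReal.ofReal (nrm z ^ 2) ∂(stdGaussianMatrix k s) := by
  obtain ⟨W, hWm, hWint, hW⟩ := exists_opNorm_sq_bound (s := s) hk
  have hb := hn.Imat_pos hk hs
  have hfin : ∫⁻ z, ENNReal.ofReal (nrm z ^ 2) ∂(stdGaussianMatrix k s) ≠ ∞ :=
    ((hu.lintegral_norm_sq_le hn hk hs).trans_lt ENNReal.ofReal_lt_top).ne
  obtain ⟨b, hbdef⟩ : ∃ b, b = nrm (Imat k s (min k s)) := ⟨_, rfl⟩
  rw [← hbdef] at hb ⊢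
  obtain ⟨r, hr⟩ : ∃ r : ℝ, r = (min k s : ℕ) := ⟨_, rfl⟩
  have hr0 : 0 < r := by
    rw [hr]; exact_mod_cast lt_min hk hs
  have hpt : ∀ z : Matrix (Fin k) (Fin s) ℝ,
      ENNReal.ofReal (2 * b / r) * ENNReal.ofReal (∑ i, ∑ j, z i j ^ 2)
      ≤ ENNReal.ofReal (332 / b) * ENNReal.ofReal (nrm z ^ 2)
        + ENNReal.ofReal (b / 332) * W z := by
    intro z
    by_cases hz : W z = ∞
    · rw [hz, ENNReal.mul_top (ENNReal.ofReal_pos.2 (by positivity)).ne', add_top]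
      exact le_top
    have hL := hu.mul_frobenius_le hn (Real.sqrt_nonneg _) (bilin_le_sqrt_toReal hz (hW z))
    rw [← hbdef, ← hr] at hL
    rw [← ENNReal.ofReal_toReal hz, ← ENNReal.ofReal_mul (by positivity),
      ← ENNReal.ofReal_mul (by positivity), ← ENNReal.ofReal_mul (by positivity),
      ← ENNReal.ofReal_add (by positivity) (by positivity)]
    refine ENNReal.ofReal_le_ofReal ?_
    have hsq := Real.sq_sqrt (ENNReal.toReal_nonneg (a := W z))
    set x := √(W z).toReal
    rw [← hsq]
    calc 2 * b / r * ∑ i, ∑ j, z i j ^ 2 = 2 / r * (b * ∑ i, ∑ j, z i j ^ 2) := by ring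
      _ ≤ 2 / r * (r * (x * nrm z)) := by gcongr
      _ = 2 * x * nrm z := by field_simp
      _ ≤ 332 / b * nrm z ^ 2 + b / 332 * x ^ 2 := by
          rw [← sub_nonneg]
          have : 332 / b * nrm z ^ 2 + b / 332 * x ^ 2 - 2 * x * nrm z
              = 332 / b * (nrm z - b / 332 * x) ^ 2 := by
            field_simp
            ring
          rw [this]
          positivity
  have hint := lintegral_mono (μ := stdGaussianMatrix k s) hpt
  have hsum : Measurable fun z : Matrix (Fin k) (Fin s) ℝ => ∑ i, ∑ j, z i j ^ 2 :=
    Finset.measurable_sum _ fun i _ => Finset.measurable_sum _ fun j _ =>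
      (measurable_matrix_entry i j).pow_const 2
  have hnm : Measurable fun z => ENNReal.ofReal (nrm z ^ 2) :=
    (hn.measurable.pow_const 2).ennreal_ofReal
  rw [lintegral_const_mul _ hsum.ennreal_ofReal, lintegral_add_left (hnm.const_mul _),
    lintegral_const_mul _ hnm, lintegral_const_mul _ hWm,
    lintegral_sum_sq_stdGaussianMatrix] at hint
  have hint2 := hint.trans (add_le_add_right (mul_le_mul_right hWint _) _)
  obtain ⟨e, he⟩ : ∃ e, e = (∫⁻ z, ENNReal.ofReal (nrm z ^ 2) ∂(stdGaussianMatrix k s)).toReal :=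
    ⟨_, rfl⟩
  have he0 : 0 ≤ e := he ▸ ENNReal.toReal_nonneg
  rw [← ENNReal.ofReal_toReal hfin, ← he] at hint2 ⊢
  rw [← ENNReal.ofReal_natCast, ← ENNReal.ofReal_natCast, ← ENNReal.ofReal_mul (by positivity),
    ← ENNReal.ofReal_mul (by positivity), ← ENNReal.ofReal_mul (by positivity),
    ← ENNReal.ofReal_mul (by positivity), ← ENNReal.ofReal_add (by positivity) (by positivity),
    ENNReal.ofReal_le_ofReal_iff (by positivity)] at hint2
  refine ENNReal.ofReal_le_ofReal ?_
  have hks : (k : ℝ) * s = r * max (k : ℝ) s := by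
    rw [hr, Nat.cast_min, min_mul_max]
  set m := max (k : ℝ) s
  rw [hks] at hint2
  have h1 : 2 * b / r * (r * m) = 2 * b * m := by field_simp
  have h2 : b / 332 * (332 * m) = b * m := by ring
  rw [h1, h2] at hint2
  have h3 : b * m ≤ 332 / b * e := by linarith
  calc 1 / 332 * m * b ^ 2 = b / 332 * (b * m) := by ring
    _ ≤ b / 332 * (332 / b * e) := by gcongr
    _ = e := by field_simp

/-- The Bayes risk under the standard Gaussian prior is bounded below by the expected squared norm
of the noise: exchanging the parameter with the noise leaves the observation unchanged. -/
theorem IsMatrixNorm.lintegral_norm_sq_le_bayes_risk (hn : IsMatrixNorm nrm)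
    {est : Matrix (Fin k) (Fin s) ℝ → Matrix (Fin k) (Fin s) ℝ} (hest : Measurable est) :
    ∫⁻ z, ENNReal.ofReal (nrm z ^ 2) ∂(stdGaussianMatrix k s)
      ≤ 4 * ∫⁻ M, ∫⁻ z, ENNReal.ofReal (nrm (est (M + z) - M) ^ 2)
          ∂(stdGaussianMatrix k s) ∂(stdGaussianMatrix k s) := by
  set γ := stdGaussianMatrix k s with hγ
  let g : Matrix (Fin k) (Fin s) ℝ → ℝ≥0∞ := fun A => ENNReal.ofReal (nrm A ^ 2)
  have hg : Measurable g := (hn.measurable.pow_const 2).ennreal_ofReal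
  have hgadd : ∀ A B, g (A + B) ≤ 2 * (g A + g B) := by
    intro A B
    simp only [g]
    rw [← ENNReal.ofReal_add (by positivity) (by positivity), ← ENNReal.ofReal_ofNat,
      ← ENNReal.ofReal_mul (by norm_num)]
    refine ENNReal.ofReal_le_ofReal ?_
    have h1 := pow_le_pow_left₀ (hn.nonneg _) (hn.1 A B) 2
    nlinarith [sq_nonneg (nrm A - nrm B)]
  have hgneg : ∀ A, g (-A) = g A := fun A => by simp only [g, hn.map_neg]
  let f : Matrix (Fin k) (Fin s) ℝ × Matrix (Fin k) (Fin s) ℝ → ℝ≥0∞ := fun p =>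
    g (est (p.1 + p.2) - p.1)
  have hf : Measurable f := hg.comp (measurable_matrix_sub
    (hest.comp (measurable_matrix_add measurable_fst measurable_snd)) measurable_fst)
  have hsub : Measurable fun p : Matrix (Fin k) (Fin s) ℝ × Matrix (Fin k) (Fin s) ℝ =>
      g (p.1 - p.2) := hg.comp (measurable_matrix_sub measurable_fst measurable_snd)
  have hadd : Measurable fun p : Matrix (Fin k) (Fin s) ℝ × Matrix (Fin k) (Fin s) ℝ =>
      g (p.1 + p.2) := hg.comp (measurable_matrix_add measurable_fst measurable_snd)
  have hdiff : ∫⁻ p, g (p.1 - p.2) ∂(γ.prod γ) ≤ 4 * ∫⁻ p, f p ∂(γ.prod γ) := by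
    calc ∫⁻ p, g (p.1 - p.2) ∂(γ.prod γ)
        ≤ ∫⁻ p, 2 * (f p + f p.swap) ∂(γ.prod γ) := by
          refine lintegral_mono fun p => ?_
          have h := hgadd (est (p.1 + p.2) - p.2) (-(est (p.1 + p.2) - p.1))
          rw [hgneg, add_comm (g _)] at h
          simp only [f, Prod.fst_swap, Prod.snd_swap, add_comm p.2 p.1]
          refine le_of_eq_of_le ?_ h
          congr 1
          abel
      _ = 4 * ∫⁻ p, f p ∂(γ.prod γ) := by
          rw [lintegral_const_mul' _ _ ENNReal.ofNat_ne_top, lintegral_add_left hf,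
            lintegral_prod_swap, ← two_mul, ← mul_assoc]
          norm_num
  have hsymm : ∫⁻ p, g (p.1 + p.2) ∂(γ.prod γ) = ∫⁻ p, g (p.1 - p.2) ∂(γ.prod γ) := by
    rw [lintegral_prod _ hadd.aemeasurable, lintegral_prod _ hsub.aemeasurable]
    refine lintegral_congr fun M => ?_
    have := (measurePreserving_neg_stdGaussianMatrix k s).lintegral_comp
      (f := fun z => g (M + z)) (hadd.comp (measurable_const.prodMk measurable_id))
    rw [← hγ] at this
    rw [← this]
    simp only [sub_eq_add_neg]
  have hjensen : 2 * ∫⁻ M, g M ∂γ ≤ 2 * ∫⁻ p, g (p.1 - p.2) ∂(γ.prod γ) := by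
    calc 2 * ∫⁻ M, g M ∂γ = ∫⁻ p, 2 * g p.1 ∂(γ.prod γ) := by
          rw [lintegral_const_mul' _ _ ENNReal.ofNat_ne_top,
            lintegral_prod (fun p => g p.1) (hg.comp measurable_fst).aemeasurable]
          simp
      _ ≤ ∫⁻ p, (g (p.1 + p.2) + g (p.1 - p.2)) ∂(γ.prod γ) := by
          refine lintegral_mono fun p => ?_
          have h := hgadd (p.1 + p.2) (p.1 - p.2)
          have h4 : g (p.1 + p.2 + (p.1 - p.2)) = 2 * (2 * g p.1) := by
            rw [add_add_sub_cancel, ← two_smul ℝ]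
            simp only [g, hn.2.1]
            rw [← ENNReal.ofReal_ofNat, ← ENNReal.ofReal_mul (by norm_num),
              ← ENNReal.ofReal_mul (by norm_num)]
            congr 1
            rw [mul_pow, sq_abs]
            ring
          rw [h4] at h
          exact (ENNReal.mul_le_mul_iff_right two_ne_zero ENNReal.ofNat_ne_top).1 h
      _ = 2 * ∫⁻ p, g (p.1 - p.2) ∂(γ.prod γ) := by
          rw [lintegral_add_left hadd, hsymm, two_mul]
  have hmain := ((ENNReal.mul_le_mul_iff_right two_ne_zero ENNReal.ofNat_ne_top).1
    hjensen).trans hdiff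
  rwa [lintegral_prod _ hf.aemeasurable] at hmain

end Risk

/-- Minimax rate for unconstrained Gaussian mean matrix estimation under
all unitarily invariant norms: there are universal constants `c, C > 0` such that for
all `k, s ≥ 1` and every unitarily invariant norm `‖·‖` on `ℝ^{k×s}`, in the model
`Y = M + Z` with `Z` a matrix of i.i.d. `N(0,1)` entries,
`c·max(k,s)·‖I_r‖² ≤ inf_{M̂} sup_M E‖M̂(M+Z) − M‖² ≤ C·max(k,s)·‖I_r‖²`, `r = min(k,s)`. -/
theorem gaussian_mean_matrix_minimax_unitarily_invariant :
    ∃ c C : ℝ, 0 < c ∧ 0 < C ∧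
      ∀ (k s : ℕ), 1 ≤ k → 1 ≤ s → ∀ nrm : Matrix (Fin k) (Fin s) ℝ → ℝ,
        IsMatrixNorm nrm → IsUnitarilyInvariant nrm →
        -- minimax lower bound
        ((∀ est : Matrix (Fin k) (Fin s) ℝ → Matrix (Fin k) (Fin s) ℝ, Measurable est →
          ∃ M : Matrix (Fin k) (Fin s) ℝ,
            ENNReal.ofReal (c * (max k s : ℝ) * nrm (Imat k s (min k s)) ^ 2)
              ≤ ∫⁻ z, ENNReal.ofReal (nrm (est (M + z) - M) ^ 2) ∂(stdGaussianMatrix k s)) ∧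
        -- minimax upper bound
        (∃ est : Matrix (Fin k) (Fin s) ℝ → Matrix (Fin k) (Fin s) ℝ, Measurable est ∧
          ∀ M : Matrix (Fin k) (Fin s) ℝ,
            (∫⁻ z, ENNReal.ofReal (nrm (est (M + z) - M) ^ 2) ∂(stdGaussianMatrix k s))
              ≤ ENNReal.ofReal (C * (max k s : ℝ) * nrm (Imat k s (min k s)) ^ 2))) := by
  refine ⟨1 / 1400, 332, by norm_num, by norm_num, fun k s hk hs nrm hn hu => ⟨?_, ?_⟩⟩
  · intro est hest
    have hb := hn.Imat_pos hk hs
    have hm : (0 : ℝ) < max (k : ℝ) s := lt_max_of_lt_left (by exact_mod_cast hk)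
    by_contra! hlt
    have hle := (hu.lintegral_norm_sq_ge hn hk hs).trans
      (hn.lintegral_norm_sq_le_bayes_risk hest)
    have hav : ∫⁻ M, ∫⁻ z, ENNReal.ofReal (nrm (est (M + z) - M) ^ 2)
          ∂(stdGaussianMatrix k s) ∂(stdGaussianMatrix k s)
        ≤ ENNReal.ofReal (1 / 1400 * max (k : ℝ) s * nrm (Imat k s (min k s)) ^ 2) := by
      refine (lintegral_mono fun M => (hlt M).le).trans ?_
      simp
    have hfin := hle.trans (mul_le_mul_right hav 4)
    rw [← ENNReal.ofReal_ofNat, ← ENNReal.ofReal_mul (by norm_num)] at hfin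
    rw [ENNReal.ofReal_le_ofReal_iff (by positivity)] at hfin
    have := mul_pos hm (pow_pos hb 2)
    linarith
  · refine ⟨id, measurable_id, fun M => ?_⟩
    have h : ∀ z, nrm (id (M + z) - M) = nrm z := fun z => by
      rw [id, add_sub_cancel_left]
    simp_rw [h]
    exact hu.lintegral_norm_sq_le hn hk hs
end
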